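/- arXiv:2403.18561 — 3 statements merged into one kernel-verified Lean document; each statement's English description precedes it below -/
import Mathlib

section
/- Let A : Fin ℓ → Fin q → ℝ be a matrix whose entries all lie in {0,1}, whose columns a_{*,j} = (A i j)_{i ∈ Fin ℓ} are pairwise distinct and all nonzero. Let λ, μ : Fin q → ℝ. If for every t : Fin ℓ → ℝ one has ∑_{j ∈ Fin q} λ_j · (exp(∑_{i ∈ Fin ℓ} A i j · t_i) − 1) = ∑_{j ∈ Fin q} μ_j · (exp(∑_{i ∈ Fin ℓ} A i j · t_i) − 1), then λ = μ. -/
/-- The character `t ↦ exp (v ⬝ᵥ t)` of the additive group `ι → ℝ`. -/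
noncomputable def expDotProductHom {ι : Type*} [Fintype ι] (v : ι → ℝ) :
    Multiplicative (ι → ℝ) →* ℝ where
  toFun t := Real.exp (v ⬝ᵥ t.toAdd)
  map_one' := by simp
  map_mul' s t := by simp [dotProduct_add, Real.exp_add]

theorem expDotProductHom_injective {ι : Type*} [Fintype ι] :
    Function.Injective (expDotProductHom (ι := ι)) := by
  classical
  intro v w h
  funext i
  have hi : Real.exp (v ⬝ᵥ Pi.single i 1) = Real.exp (w ⬝ᵥ Pi.single i 1) :=
    DFunLike.congr_fun h (Multiplicative.ofAdd (Pi.single i 1))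
  simpa using hi

/-- Exponentials with distinct frequency vectors are linearly independent. -/
theorem linearIndependent_exp_dotProduct {ι κ : Type*} [Fintype ι] {v : κ → ι → ℝ}
    (hv : Function.Injective v) :
    LinearIndependent ℝ (fun k => fun t : ι → ℝ => Real.exp (v k ⬝ᵥ t)) :=
  (linearIndependent_monoidHom (Multiplicative (ι → ℝ)) ℝ).comp
    (fun k => expDotProductHom (v k)) (expDotProductHom_injective.comp hv)

theorem cgf_identifiability {ℓ q : ℕ} (A : Fin ℓ → Fin q → ℝ)
    (hA01 : ∀ i j, A i j = 0 ∨ A i j = 1)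
    (hcols : Function.Injective (fun j : Fin q => fun i : Fin ℓ => A i j))
    (hnz : ∀ j : Fin q, (fun i : Fin ℓ => A i j) ≠ 0)
    (lam mu : Fin q → ℝ)
    (h : ∀ t : Fin ℓ → ℝ,
      ∑ j : Fin q, lam j * (Real.exp (∑ i : Fin ℓ, A i j * t i) - 1) =
      ∑ j : Fin q, mu j * (Real.exp (∑ i : Fin ℓ, A i j * t i) - 1)) :
    lam = mu := by
  let v : Option (Fin q) → Fin ℓ → ℝ := fun o => o.elim 0 fun j i => A i j
  have hv : Function.Injective v := by
    rintro (_ | j) (_ | k) hjk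
    · rfl
    · exact absurd hjk.symm (hnz k)
    · exact absurd hjk (hnz j)
    · exact congrArg some (hcols hjk)
  let c : Option (Fin q) → ℝ := fun o => o.elim (-∑ j, (lam j - mu j)) fun j => lam j - mu j
  have hc := Fintype.linearIndependent_iff.mp (linearIndependent_exp_dotProduct hv) c <| by
    funext t
    have ht := h t
    simp only [mul_sub, mul_one, Finset.sum_sub_distrib] at ht
    simp only [Fintype.sum_option, Finset.sum_apply, Pi.smul_apply, smul_eq_mul,
      Pi.zero_apply, v, c, Option.elim, dotProduct, zero_mul, Finset.sum_const_zero, Real.exp_zero, mul_one,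
      sub_mul, Finset.sum_sub_distrib]
    linarith
  exact funext fun j => sub_eq_zero.mp (hc (some j))
end

section
/- Let α be a partial order, r a natural number, and v : Fin r → α an injective map. Define the matrix M : Matrix (Fin r) (Fin r) ℝ by M i j = 1 if v i ≤ v j and M i j = 0 otherwise. Then det M = 1. -/
theorem Matrix.BlockTriangular.det_eq_prod_diag_of_injective {m α R : Type*} [Fintype m]
    [DecidableEq m] [LinearOrder α] [CommRing R] {M : Matrix m m R} {b : m → α}
    (hM : M.BlockTriangular b) (hb : Function.Injective b) : M.det = ∏ i, M i i := by
  rw [hM.det, Finset.prod_image hb.injOn]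
  refine Finset.prod_congr rfl fun i _ => ?_
  let _ : Unique {j // b j = b i} := ⟨⟨⟨i, rfl⟩⟩, fun j => Subtype.ext (hb j.2)⟩
  exact Matrix.det_unique _

theorem toLinearExtension_injective {α : Type*} [PartialOrder α] :
    Function.Injective (toLinearExtension : α →o LinearExtension α) :=
  fun _ _ h => h

theorem order_incidence_matrix_det_eq_one {α : Type*} [PartialOrder α]
    [DecidableRel ((· ≤ ·) : α → α → Prop)]
    {r : ℕ} (v : Fin r → α) (hv : Function.Injective v) :
    (Matrix.of fun i j : Fin r => if v i ≤ v j then (1 : ℝ) else 0).det = 1 := by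
  have hM : (Matrix.of fun i j : Fin r => if v i ≤ v j then (1 : ℝ) else 0).BlockTriangular
      fun i => toLinearExtension (v i) :=
    fun _ _ hij => if_neg fun h => hij.not_ge (toLinearExtension.monotone h)
  rw [hM.det_eq_prod_diag_of_injective (toLinearExtension_injective.comp hv)]
  simp
end

section
/- Let A : Fin ℓ → Fin q → ℝ be a matrix whose entries all lie in {0,1}, let λ : Fin q → ℝ, and define K : (Fin ℓ → ℝ) → ℝ by K(t) = ∑_{j ∈ Fin q} λ_j · (exp(∑_{i ∈ Fin ℓ} A i j · t_i) − 1). Let p ≥ 1 and let ι : Fin p → Fin ℓ be injective. Then the p-th iterated Fréchet derivative of K at t = 0, evaluated on the tuple of coordinate basis vectors (e_{ι(0)}, …, e_{ι(p−1)}) (where e_i = Pi.single i 1), equals ∑_{j ∈ Fin q, ∀ k, A (ι k) j = 1} λ_j. -/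
theorem iteratedDeriv_exp_sub_one {n : ℕ} (hn : n ≠ 0) :
    iteratedDeriv n (fun x : ℝ => Real.exp x - 1) = Real.exp := by
  obtain ⟨m, rfl⟩ := Nat.exists_eq_succ_of_ne_zero hn
  have h : deriv (fun x : ℝ => Real.exp x - 1) = Real.exp := by
    ext x
    simp
  rw [iteratedDeriv_succ', h, iteratedDeriv_eq_iterate, Real.iter_deriv_exp]

theorem iteratedFDeriv_exp_clm_sub_one_apply {E : Type*} [NormedAddCommGroup E] [NormedSpace ℝ E]
    (L : E →L[ℝ] ℝ) {n : ℕ} (hn : n ≠ 0) (x : E) (v : Fin n → E) :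
    iteratedFDeriv ℝ n (fun t => Real.exp (L t) - 1) x v = Real.exp (L x) * ∏ k, L (v k) := by
  have hf : ContDiff ℝ n (fun y : ℝ => Real.exp y - 1) := by fun_prop
  have h := L.iteratedFDeriv_comp_right hf x le_rfl
  change iteratedFDeriv ℝ n ((fun y : ℝ => Real.exp y - 1) ∘ L) x v = _
  rw [h, ContinuousMultilinearMap.compContinuousLinearMap_apply,
    iteratedFDeriv_apply_eq_iteratedDeriv_mul_prod, iteratedDeriv_exp_sub_one hn, smul_eq_mul,
    mul_comm]

theorem joint_cumulant_of_poisson_cgf {ℓ q : ℕ} (A : Fin ℓ → Fin q → ℝ)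
    (hA01 : ∀ i j, A i j = 0 ∨ A i j = 1) (lam : Fin q → ℝ)
    (K : (Fin ℓ → ℝ) → ℝ)
    (hK : K = fun t => ∑ j : Fin q, lam j * (Real.exp (∑ i : Fin ℓ, A i j * t i) - 1))
    (p : ℕ) (hp : 1 ≤ p) (ι : Fin p → Fin ℓ) (hι : Function.Injective ι) :
    iteratedFDeriv ℝ p K 0 (fun k : Fin p => Pi.single (ι k) (1 : ℝ)) =
      ∑ j ∈ Finset.univ.filter (fun j : Fin q => ∀ k : Fin p, A (ι k) j = 1), lam j := by
  let L : Fin q → (Fin ℓ → ℝ) →L[ℝ] ℝ := fun j =>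
    ∑ i, A i j • ContinuousLinearMap.proj (R := ℝ) (φ := fun _ : Fin ℓ => ℝ) i
  have hL : ∀ j t, L j t = ∑ i, A i j * t i := fun j t => by simp [L]
  have hL_single : ∀ j i, L j (Pi.single i 1) = A i j := fun j i => by
    simp [hL, Pi.single_apply]
  have hK' : K = fun t => ∑ j, lam j • (Real.exp (L j t) - 1) := by
    simp only [hK, hL, smul_eq_mul]
  have hsmooth : ∀ j, ContDiff ℝ p fun t => Real.exp (L j t) - 1 := fun j => by fun_prop
  rw [hK', iteratedFDeriv_fun_sum_apply fun j _ => ((hsmooth j).const_smul (lam j)).contDiffAt,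
    sum_apply, Finset.sum_filter]
  refine Finset.sum_congr rfl fun j _ => ?_
  rw [iteratedFDeriv_const_smul_apply' (hsmooth j).contDiffAt,
    smul_apply,
    iteratedFDeriv_exp_clm_sub_one_apply (L j) (Nat.one_le_iff_ne_zero.mp hp)]
  simp only [map_zero, Real.exp_zero, one_mul, hL_single, smul_eq_mul]
  split_ifs with h
  · simp [h]
  · obtain ⟨k, hk⟩ := not_forall.mp h
    rw [Finset.prod_eq_zero (Finset.mem_univ k) ((hA01 (ι k) j).resolve_right hk), mul_zero]
end
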